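/- arXiv:2004.03795 — 2 statements merged into one kernel-verified Lean document; each statement's English description precedes it below -/
import Mathlib

section
/- (Minimal uniquely ergodic weights.) Let A ⊂ ℝ be a finite set and w = (w_n) ∈ A^ℕ. Let Θ be the shift on A^ℕ and let Ω_w be the closure of the forward orbit {Θ^k w : k ≥ 0} in A^ℕ. Assume the subshift (Ω_w, Θ) is minimal (every point of Ω_w has dense forward orbit in Ω_w) and uniquely ergodic (it carries exactly one Θ-invariant Borel probability measure). Let f: X → ℝ be of bounded variation. Then: (i) for every λ ∈ ℝ the limit φ(λ) := lim_{N→∞} (1/N) log ∫_X exp(λ Σ_{n=0}^{N−1} w_n f(T^n x)) dσ(x) exists (hypothesis (H1) holds for f_n := w_n · f∘T^n composed appropriately); and (ii) there is D < ∞ such that for all N ≥ 1 and x, y ∈ X agreeing in coordinates 0,…,N−1, Σ_{k=0}^{N−1} |w_k f(T^k x) − w_k f(T^k y)| ≤ D (hypothesis (H2) holds). -/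
open MeasureTheory Filter Finset
open scoped ENNReal Topology

noncomputable section

/-- The shift map `T` on `ℕ → S`, `(Tx)_n = x_{n+1}`. -/
def shift {S : Type*} (x : ℕ → S) : ℕ → S := fun n => x (n + 1)

/-- The cylinder `[a_0, …, a_{m-1}]` of all `y` with `y_i = a_i` for `0 ≤ i < m`. -/
def cyl {S : Type*} {m : ℕ} (a : Fin m → S) : Set (ℕ → S) :=
  {y : ℕ → S | ∀ i : Fin m, y i = a i}

/-- The partial weighted Birkhoff sum `S_{m,n} f(x) = ∑_{k=m}^{n-1} f_k(T^k x)`. -/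
def birk {S : Type*} (f : ℕ → (ℕ → S) → ℝ) (m n : ℕ) (x : ℕ → S) : ℝ :=
  ∑ k ∈ Finset.Ico m n, f k (shift^[k] x)

/-- The partition function `Z_{m,n}(λ) = ∫ exp(λ S_{m,n}f) dσ`. -/
def Zmn {S : Type*} [MeasurableSpace S] (σ : Measure (ℕ → S))
    (f : ℕ → (ℕ → S) → ℝ) (lam : ℝ) (m n : ℕ) : ℝ :=
  ∫ x, Real.exp (lam * birk f m n x) ∂σ

/-- Hypothesis (H2): uniformly bounded distortion. -/
def H2 {S : Type*} (f : ℕ → (ℕ → S) → ℝ) (D : ℝ) : Prop :=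
  ∀ N : ℕ, 1 ≤ N → ∀ x y : ℕ → S, (∀ i, i < N → x i = y i) →
    ∑ k ∈ Finset.range N, |f k (shift^[k] x) - f k (shift^[k] y)| ≤ D

theorem almost_additive_limit (c : ℕ → ℕ → ℝ) (E B : ℝ) (hE : 0 ≤ E) (hB : 0 ≤ B)
    (h1 : ∀ i m, |c 0 (i + m) - c 0 i - c i m| ≤ E)
    (h2 : ∀ i m, |c i m| ≤ m * B)
    (h3 : ∀ m, ∃ l : ℝ, Tendsto (fun N : ℕ => (∑ i ∈ range N, c i m) / N) atTop (𝓝 l)) :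
    ∃ L : ℝ, Tendsto (fun N : ℕ => c 0 N / N) atTop (𝓝 L) := by
  have key : ∀ m N : ℕ, |∑ i ∈ range N, c i m - m * c 0 N| ≤ N * E + m * (E + 2 * m * B) := by
    intro m N
    have e1 : ∑ i ∈ range N, (c 0 (i + m) - c 0 i) = ∑ j ∈ range m, (c 0 (N + j) - c 0 j) := by
      have t1 := Finset.sum_range_add (fun i => c 0 i) N m
      have t2 := Finset.sum_range_add (fun i => c 0 i) m N
      rw [add_comm m N] at t2
      simp only [Finset.sum_sub_distrib]
      have : ∑ i ∈ range N, c 0 (i + m) = ∑ i ∈ range N, c 0 (m + i) :=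
        Finset.sum_congr rfl fun i _ => by rw [add_comm]
      rw [this]; linarith
    have e2 : |∑ i ∈ range N, (c i m - (c 0 (i + m) - c 0 i))| ≤ N * E := by
      refine (Finset.abs_sum_le_sum_abs _ _).trans ?_
      refine (Finset.sum_le_card_nsmul _ _ E fun i _ => ?_).trans (by simp)
      rw [abs_sub_comm]; exact h1 i m
    have e3 : |∑ j ∈ range m, (c 0 (N + j) - c 0 j - c 0 N)| ≤ m * (E + 2 * m * B) := by
      refine (Finset.abs_sum_le_sum_abs _ _).trans ?_
      refine (Finset.sum_le_card_nsmul _ _ (E + 2 * m * B) fun j hj => ?_).trans (by simp [mul_add])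
      have hjm : (j : ℝ) * B ≤ m * B := by
        have := (Finset.mem_range.1 hj).le
        gcongr
      have a1 := abs_le.1 (h1 N j)
      have a2 := abs_le.1 (h2 0 j)
      have a3 := abs_le.1 (h2 N j)
      rw [abs_le]; constructor <;> linarith
    have e4 : ∑ i ∈ range N, c i m - m * c 0 N =
        ∑ i ∈ range N, (c i m - (c 0 (i + m) - c 0 i)) +
        ∑ j ∈ range m, (c 0 (N + j) - c 0 j - c 0 N) := by
      rw [Finset.sum_sub_distrib, e1, Finset.sum_sub_distrib (fun j => c 0 (N + j) - c 0 j)]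
      simp
    rw [e4]
    exact (abs_add_le _ _).trans (add_le_add e2 e3)
  apply cauchySeq_tendsto_of_complete
  rw [Metric.cauchySeq_iff']
  intro ε hε
  obtain ⟨m, hm⟩ := exists_nat_gt (E / (ε / 8))
  have hm0 : (0 : ℝ) < m := lt_of_le_of_lt (by positivity) hm
  have hEm : E ≤ m * (ε / 8) := by
    rw [div_lt_iff₀ (by positivity)] at hm; exact hm.le
  obtain ⟨l, hl⟩ := h3 m
  have hK : Tendsto (fun N : ℕ => (m * (E + 2 * m * B)) / (N : ℝ)) atTop (𝓝 0) :=
    tendsto_const_div_atTop_nhds_zero_nat _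
  have ev1 := hl.eventually (Metric.ball_mem_nhds l (show 0 < m * (ε / 8) by positivity))
  have ev2 := hK.eventually (gt_mem_nhds (show 0 < m * (ε / 8) by positivity))
  have ev : ∀ᶠ N : ℕ in atTop, |c 0 N / N - l / m| < ε / 2 := by
    filter_upwards [ev1, ev2, eventually_gt_atTop 0] with N a1 a2 a3
    have hN : (0 : ℝ) < N := by exact_mod_cast a3
    rw [Real.dist_eq] at a1
    have k := key m N
    have k2 : |(∑ i ∈ range N, c i m) / N - m * (c 0 N / N)| ≤ E + m * (E + 2 * m * B) / N := by
      have : (∑ i ∈ range N, c i m) / N - m * (c 0 N / N)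
        = (∑ i ∈ range N, c i m - m * c 0 N) / N := by field_simp
      rw [this, abs_div, abs_of_pos hN, div_le_iff₀ hN]
      have : (E + m * (E + 2 * m * B) / N) * N = N * E + m * (E + 2 * m * B) := by field_simp
      rw [this]; exact k
    have k3 : |m * (c 0 N / N) - l| < m * (ε / 2) := by
      have b1 := abs_le.1 k2
      have b2 := abs_lt.1 a1
      rw [abs_lt]; constructor <;> linarith
    have : c 0 N / N - l / m = (m * (c 0 N / N) - l) / m := by field_simp
    rw [this, abs_div, abs_of_pos hm0, div_lt_iff₀ hm0]
    linarith
  obtain ⟨N0, hN0⟩ := eventually_atTop.1 ev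
  refine ⟨N0, fun n hn => ?_⟩
  have b1 := abs_lt.1 (hN0 n hn)
  have b2 := abs_lt.1 (hN0 N0 le_rfl)
  rw [Real.dist_eq, abs_lt]; constructor <;> linarith

theorem continuous_shift' {S : Type*} [TopologicalSpace S] : Continuous (shift (S := S)) :=
  continuous_pi fun n => continuous_apply (n + 1)

theorem shift_iter {S : Type*} (k : ℕ) (x : ℕ → S) (n : ℕ) : shift^[k] x n = x (n + k) := by
  induction k generalizing x with
  | zero => rfl
  | succ k ih => rw [Function.iterate_succ_apply, ih]; simp [shift, add_assoc]

/-- empirical measure -/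
def empi (w : ℕ → ℝ) (N : ℕ) : Measure (ℕ → ℝ) :=
  ((N : ℝ≥0∞) + 1)⁻¹ • ∑ i ∈ range (N + 1), Measure.dirac (shift^[i] w)

theorem empi_apply_one (w : ℕ → ℝ) (N : ℕ) (K : Set (ℕ → ℝ)) (hK : MeasurableSet K)
    (h : ∀ i, shift^[i] w ∈ K) : empi w N K = 1 := by
  simp only [empi, Measure.smul_apply, Measure.finsetSum_apply, smul_eq_mul]
  rw [Finset.sum_congr rfl (fun i _ => by
    rw [Measure.dirac_apply' _ hK, Set.indicator_of_mem (h i), Pi.one_apply])]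
  simp only [sum_const, card_range, nsmul_eq_mul, mul_one]
  push_cast
  exact ENNReal.inv_mul_cancel (by simp) (by finiteness)

instance (w : ℕ → ℝ) (N : ℕ) : IsProbabilityMeasure (empi w N) :=
  ⟨empi_apply_one w N _ MeasurableSet.univ fun _ => Set.mem_univ _⟩

theorem empi_integral (w : ℕ → ℝ) (N : ℕ) (g : BoundedContinuousFunction (ℕ → ℝ) ℝ) :
    ∫ x, g x ∂(empi w N) = (∑ i ∈ range (N + 1), g (shift^[i] w)) / ((N : ℝ) + 1) := by
  rw [empi, integral_smul_measure, integral_finsetSum_measure]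
  · simp only [integral_dirac]
    have : (((N : ℝ≥0∞) + 1)⁻¹).toReal = ((N : ℝ) + 1)⁻¹ := by
      rw [ENNReal.toReal_inv, ENNReal.toReal_add (by finiteness) (by finiteness)]; simp
    rw [this, smul_eq_mul, div_eq_inv_mul]
  · intro i _
    exact g.integrable _

theorem ue_tendsto (A : Finset ℝ) (w : ℕ → ℝ) (hw : ∀ n, w n ∈ A)
    (Ωw : Set (ℕ → ℝ)) (hΩw : Ωw = closure {z : ℕ → ℝ | ∃ k : ℕ, z = shift^[k] w})
    (hUE : ∃! m : ProbabilityMeasure (ℕ → ℝ),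
      MeasurePreserving (shift (S := ℝ)) (m : Measure (ℕ → ℝ)) (m : Measure (ℕ → ℝ)) ∧
        (m : Measure (ℕ → ℝ)) Ωw = 1)
    (g : BoundedContinuousFunction (ℕ → ℝ) ℝ) :
    ∃ l : ℝ, Tendsto (fun N : ℕ => (∑ i ∈ range N, g (shift^[i] w)) / N) atTop (𝓝 l) := by
  obtain ⟨m, -, hm⟩ := hUE
  have hcl : IsClosed Ωw := hΩw ▸ isClosed_closure
  have horb : ∀ i, shift^[i] w ∈ Ωw := fun i => hΩw ▸ subset_closure ⟨i, rfl⟩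
  let μ : ℕ → ProbabilityMeasure (ℕ → ℝ) := fun N => ⟨empi w N, inferInstance⟩
  have hcomp : IsCompact (closure (Set.range μ)) := by
    apply isCompact_closure_of_isTightMeasureSet
    rw [isTightMeasureSet_iff_exists_isCompact_measure_compl_le]
    intro ε hε
    have hKc : IsCompact (Set.pi Set.univ fun _ : ℕ => (A : Set ℝ)) :=
      isCompact_univ_pi fun _ => A.finite_toSet.isCompact
    refine ⟨_, hKc, ?_⟩
    rintro _ ⟨_, ⟨N, rfl⟩, rfl⟩
    have : (empi w N) (Set.pi Set.univ fun _ : ℕ => (A : Set ℝ)) = 1 :=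
      empi_apply_one w N _ hKc.measurableSet fun i n _ => by rw [shift_iter]; exact hw _
    have h0 := (prob_compl_eq_zero_iff (μ := empi w N) hKc.measurableSet).2 this
    change empi w N _ ≤ ε
    rw [h0]; exact zero_le
  have hinv : ∀ g : BoundedContinuousFunction (ℕ → ℝ) ℝ,
      Tendsto (fun N => ∫ x, g (shift x) ∂(empi w N) - ∫ x, g x ∂(empi w N)) atTop (𝓝 0) := by
    intro g
    let g' : BoundedContinuousFunction (ℕ → ℝ) ℝ :=
      g.compContinuous ⟨shift, continuous_shift'⟩
    have e : ∀ N, ∫ x, g (shift x) ∂(empi w N) - ∫ x, g x ∂(empi w N)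
        = (g (shift^[N + 1] w) - g w) / ((N : ℝ) + 1) := by
      intro N
      have := empi_integral w N g'
      have h2 : ∫ x, g (shift x) ∂(empi w N) = ∫ x, g' x ∂(empi w N) := rfl
      rw [h2, this, empi_integral, ← sub_div, ← Finset.sum_sub_distrib]
      congr 1
      have h3 : ∀ i, g' (shift^[i] w) = g (shift^[i + 1] w) := fun i => by
        rw [Function.iterate_succ_apply']; rfl
      simp only [h3]
      rw [Finset.sum_range_sub (fun i => g (shift^[i] w))]; rfl
    simp only [e]
    have hz : Tendsto (fun N : ℕ => (2 * ‖g‖) / ((N : ℝ) + 1)) atTop (𝓝 0) := by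
      have := (tendsto_const_div_atTop_nhds_zero_nat (2 * ‖g‖)).comp (tendsto_add_atTop_nat 1)
      refine this.congr fun N => by simp
    refine squeeze_zero_norm (fun N => ?_) hz
    rw [norm_div, Real.norm_of_nonneg (show (0 : ℝ) ≤ (N : ℝ) + 1 by positivity)]
    gcongr
    refine (norm_sub_le _ _).trans ?_
    have := g.norm_coe_le_norm (shift^[N + 1] w)
    have := g.norm_coe_le_norm w
    linarith
  have hT : Tendsto μ atTop (𝓝 m) := by
    rw [tendsto_iff_ultrafilter]
    intro U hU
    have hmem : (↑(U.map μ) : Filter (ProbabilityMeasure (ℕ → ℝ))) ≤ 𝓟 (closure (Set.range μ)) := by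
      rw [le_principal_iff]
      exact Filter.mem_map.2 (Filter.univ_mem' fun N => subset_closure ⟨N, rfl⟩)
    obtain ⟨ν, -, hν⟩ := hcomp.ultrafilter_le_nhds _ hmem
    have hν' : Tendsto μ U (𝓝 ν) := hν
    have : ν = m := by
      apply hm
      constructor
      · refine ⟨continuous_shift'.measurable, ?_⟩
        have : IsProbabilityMeasure ((ν : Measure (ℕ → ℝ)).map shift) :=
          Measure.isProbabilityMeasure_map continuous_shift'.measurable.aemeasurable
        apply ext_of_forall_integral_eq_of_IsFiniteMeasure
        intro g
        rw [integral_map continuous_shift'.measurable.aemeasurable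
          g.continuous.aestronglyMeasurable]
        have t := ProbabilityMeasure.tendsto_iff_forall_integral_tendsto.1 hν'
        have t1 := t g
        have t2 := t (g.compContinuous ⟨shift, continuous_shift'⟩)
        have t3 := (hinv g).mono_left hU
        have t4 := tendsto_nhds_unique (t2.sub t1) t3
        exact sub_eq_zero.1 t4
      · refine le_antisymm prob_le_one ?_
        have := ProbabilityMeasure.limsup_measure_closed_le_of_tendsto hν' hcl
        refine le_trans (le_of_eq ?_) this
        have e : ∀ N, ((μ N : Measure (ℕ → ℝ)) Ωw) = 1 := fun N =>
          empi_apply_one w N _ hcl.measurableSet horb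
        simp only [e]
        exact (limsup_const 1).symm
    rw [← this]; exact hν'
  refine ⟨∫ x, g x ∂(m : Measure (ℕ → ℝ)), ?_⟩
  have t := ProbabilityMeasure.tendsto_iff_forall_integral_tendsto.1 hT g
  rw [← tendsto_add_atTop_iff_nat 1]
  refine t.congr fun N => ?_
  have := empi_integral w N g
  push_cast
  exact this

section bern
variable {S : Type*} [Fintype S] [TopologicalSpace S]
    [DiscreteTopology S] [MeasurableSpace S] [BorelSpace S]

theorem cyl_meas {m : ℕ} (a : Fin m → S) : MeasurableSet (cyl a) := by
  have : cyl a = ⋂ i : Fin m, (fun y : ℕ → S => y i) ⁻¹' {a i} := by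
    ext y; simp [cyl]
  rw [this]
  exact MeasurableSet.iInter fun i => measurable_pi_apply _ (measurableSet_singleton _)

theorem restr_map (σ : Measure (ℕ → S)) [IsProbabilityMeasure σ]
    (hσ : ∀ (m : ℕ) (a : Fin m → S), σ (cyl a) = (Fintype.card S : ℝ≥0∞)⁻¹ ^ m)
    (n : ℕ) (a : Fin n → S) :
    (σ.restrict (cyl a)).map (shift^[n]) = ((Fintype.card S : ℝ≥0∞)⁻¹ ^ n) • σ := by
  have hms : Measurable (shift^[n] : (ℕ → S) → (ℕ → S)) := (continuous_shift'.iterate n).measurable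
  have hfin : IsFiniteMeasure ((σ.restrict (cyl a)).map (shift^[n])) := inferInstance
  have hC := PiNat.isTopologicalBasis_cylinders (fun _ : ℕ => S)
  refine ext_of_generate_finite _ ((BorelSpace.measurable_eq).trans hC.borel_eq_generateFrom)
    ?_ ?_ ?_
  · rintro _ ⟨x, k, rfl⟩ _ ⟨y, l, rfl⟩ ⟨z, hz1, hz2⟩
    refine ⟨z, max k l, ?_⟩
    ext u
    simp only [Set.mem_inter_iff, PiNat.mem_cylinder_iff] at *
    constructor
    · rintro ⟨h1, h2⟩ i hi
      rcases lt_max_iff.1 hi with h | h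
      · rw [h1 i h, hz1 i h]
      · rw [h2 i h, hz2 i h]
    · intro h
      exact ⟨fun i hi => by rw [h i (lt_max_of_lt_left hi), hz1 i hi],
        fun i hi => by rw [h i (lt_max_of_lt_right hi), hz2 i hi]⟩
  · rintro _ ⟨x, k, rfl⟩
    have hmeas : MeasurableSet (PiNat.cylinder x k) := (PiNat.isOpen_cylinder _ x k).measurableSet
    rw [Measure.map_apply hms hmeas, Measure.restrict_apply (hms hmeas), Measure.smul_apply,
      smul_eq_mul]
    have e1 : PiNat.cylinder x k = cyl (fun i : Fin k => x i) := by
      ext y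
      simp only [PiNat.mem_cylinder_iff, cyl, Set.mem_ofPred_eq]
      exact ⟨fun h i => h i i.2, fun h i hi => h ⟨i, hi⟩⟩
    have e2 : (shift^[n]) ⁻¹' (PiNat.cylinder x k) ∩ cyl a =
        cyl (fun i : Fin (n + k) => if h : (i : ℕ) < n then a ⟨i, h⟩ else x (i - n)) := by
      ext y
      simp only [Set.mem_inter_iff, Set.mem_preimage, PiNat.mem_cylinder_iff, cyl,
        Set.mem_ofPred_eq, shift_iter]
      constructor
      · rintro ⟨h1, h2⟩ i
        split_ifs with h
        · exact h2 ⟨i, h⟩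
        · have := h1 (i - n) (by omega)
          rwa [Nat.sub_add_cancel (by omega)] at this
      · intro h
        constructor
        · intro i hi
          have := h ⟨i + n, by omega⟩
          simpa using this
        · intro i
          have := h ⟨i, by omega⟩
          simpa using this
    rw [e2, hσ, e1, hσ, pow_add]
  · rw [Measure.map_apply hms MeasurableSet.univ]
    simp [hσ]

theorem cont_int (σ : Measure (ℕ → S)) [IsProbabilityMeasure σ] {F : (ℕ → S) → ℝ}
    (hF : Continuous F) : Integrable F σ :=
  hF.integrable_of_hasCompactSupport (HasCompactSupport.of_compactSpace F)

theorem quasi [Nonempty S] (σ : Measure (ℕ → S)) [IsProbabilityMeasure σ]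
    (hσ : ∀ (m : ℕ) (a : Fin m → S), σ (cyl a) = (Fintype.card S : ℝ≥0∞)⁻¹ ^ m)
    (n : ℕ) (F G : (ℕ → S) → ℝ) (hF : Continuous F) (hG : Continuous G)
    (hG0 : ∀ x, 0 < G x) (C : ℝ) (hC : 0 ≤ C)
    (hd : ∀ x y : ℕ → S, (∀ i, i < n → x i = y i) → F x ≤ C * F y) :
    ∫ x, F x * G (shift^[n] x) ∂σ ≤ C * C * ((∫ x, F x ∂σ) * ∫ x, G x ∂σ) ∧
    (∫ x, F x ∂σ) * (∫ x, G x ∂σ) ≤ C * C * ∫ x, F x * G (shift^[n] x) ∂σ := by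
  have hGn : Continuous fun x => G (shift^[n] x) := hG.comp (continuous_shift'.iterate n)
  have hFG : Continuous fun x => F x * G (shift^[n] x) := hF.mul hGn
  have split : ∀ h : (ℕ → S) → ℝ, Continuous h →
      ∫ x, h x ∂σ = ∑ a : Fin n → S, ∫ x in cyl a, h x ∂σ := by
    intro h hh
    rw [← integral_iUnion_fintype (fun a => cyl_meas a) ?_
      (fun a => (cont_int σ hh).integrableOn)]
    · have : (⋃ a : Fin n → S, cyl a) = Set.univ := by
        ext x; simp only [Set.mem_iUnion, Set.mem_univ, iff_true]
        exact ⟨fun i => x i, fun i => rfl⟩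
      rw [this, setIntegral_univ]
    · intro a b hab
      refine Set.disjoint_left.2 fun x hx hy => hab ?_
      ext i; rw [← hx i, ← hy i]
  have hGi : 0 ≤ ∫ x, G x ∂σ := integral_nonneg fun x => (hG0 x).le
  set p : ℝ := ((Fintype.card S : ℝ≥0∞)⁻¹ ^ n).toReal with hp
  have hp0 : 0 ≤ p := ENNReal.toReal_nonneg
  have hGa : ∀ a : Fin n → S, ∫ x in cyl a, G (shift^[n] x) ∂σ = p * ∫ x, G x ∂σ := by
    intro a
    have := integral_map (μ := σ.restrict (cyl a)) (φ := shift^[n])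
      (continuous_shift'.iterate n).measurable.aemeasurable (f := G) hG.aestronglyMeasurable
    rw [← this, restr_map σ hσ, integral_smul_measure, smul_eq_mul]
  have h1a : ∀ (a : Fin n → S) (c : ℝ), ∫ x in cyl a, c ∂σ = p * c := by
    intro a c
    rw [setIntegral_const, Measure.real, hσ, smul_eq_mul]
  have main : ∀ a : Fin n → S,
      ∫ x in cyl a, F x * G (shift^[n] x) ∂σ
        ≤ C * C * ((∫ x in cyl a, F x ∂σ) * ∫ x, G x ∂σ) ∧
      (∫ x in cyl a, F x ∂σ) * (∫ x, G x ∂σ)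
        ≤ C * C * ∫ x in cyl a, F x * G (shift^[n] x) ∂σ := by
    intro a
    obtain ⟨xa, hxa⟩ : ∃ x : ℕ → S, x ∈ cyl a :=
      ⟨fun i => if h : i < n then a ⟨i, h⟩ else Classical.arbitrary S, fun i => by simp⟩
    have agree : ∀ x ∈ cyl a, ∀ y ∈ cyl a, F x ≤ C * F y := fun x hx y hy =>
      hd x y fun i hi => (hx ⟨i, hi⟩).trans (hy ⟨i, hi⟩).symm
    have iF := (cont_int σ hF).integrableOn (s := cyl a)
    have iG := (cont_int σ hGn).integrableOn (s := cyl a)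
    have iFG := (cont_int σ hFG).integrableOn (s := cyl a)
    have ic : ∀ c : ℝ, IntegrableOn (fun _ : ℕ → S => c) (cyl a) σ := fun c =>
      (cont_int σ continuous_const).integrableOn
    have b1 : ∫ x in cyl a, F x * G (shift^[n] x) ∂σ ≤ C * F xa * (p * ∫ x, G x ∂σ) := by
      rw [← hGa a, ← integral_const_mul]
      exact setIntegral_mono_on iFG (iG.const_mul _) (cyl_meas a) fun x hx =>
        mul_le_mul_of_nonneg_right (agree x hx xa hxa) (hG0 _).le
    have b2 : F xa * (p * ∫ x, G x ∂σ) ≤ C * ∫ x in cyl a, F x * G (shift^[n] x) ∂σ := by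
      rw [← hGa a, ← integral_const_mul, ← integral_const_mul]
      exact setIntegral_mono_on (iG.const_mul _) (iFG.const_mul _) (cyl_meas a) fun x hx => by
        rw [← mul_assoc]
        exact mul_le_mul_of_nonneg_right (agree xa hxa x hx) (hG0 _).le
    have b3 : ∫ x in cyl a, F x ∂σ ≤ p * (C * F xa) := by
      rw [← h1a a]
      exact setIntegral_mono_on iF (ic _) (cyl_meas a) fun x hx => agree x hx xa hxa
    have b4 : p * F xa ≤ C * ∫ x in cyl a, F x ∂σ := by
      rw [← h1a a, ← integral_const_mul]
      exact setIntegral_mono_on (ic _) (iF.const_mul _) (cyl_meas a) fun x hx => agree xa hxa x hx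
    constructor
    · calc _ ≤ _ := b1
        _ = (C * ∫ x, G x ∂σ) * (p * F xa) := by ring
        _ ≤ (C * ∫ x, G x ∂σ) * (C * ∫ x in cyl a, F x ∂σ) := by gcongr
        _ = _ := by ring
    · calc _ ≤ p * (C * F xa) * ∫ x, G x ∂σ := by gcongr
        _ = C * (F xa * (p * ∫ x, G x ∂σ)) := by ring
        _ ≤ C * (C * ∫ x in cyl a, F x * G (shift^[n] x) ∂σ) := by gcongr
        _ = _ := by ring
  rw [split _ hF, split _ hFG]
  constructor
  · rw [Finset.sum_mul, Finset.mul_sum]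
    exact Finset.sum_le_sum fun a _ => (main a).1
  · rw [Finset.sum_mul, Finset.mul_sum]
    exact Finset.sum_le_sum fun a _ => (main a).2

theorem f_cont (f : (ℕ → S) → ℝ) (v : ℕ → ℝ) (hv : Tendsto v atTop (𝓝 0))
    (hvar : ∀ (n : ℕ) (x y : ℕ → S), (∀ i, i < n → x i = y i) → |f x - f y| ≤ v n) :
    Continuous f := by
  rw [continuous_iff_continuousAt]
  intro x
  rw [ContinuousAt, Metric.tendsto_nhds]
  intro ε hε
  obtain ⟨n, hn⟩ := (hv.eventually (gt_mem_nhds hε)).exists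
  filter_upwards [(PiNat.isOpen_cylinder _ x n).mem_nhds (PiNat.self_mem_cylinder x n)] with y hy
  rw [Real.dist_eq]
  exact (hvar n y x fun i hi => hy i hi).trans_lt hn

theorem distortion [Nonempty S] (f : (ℕ → S) → ℝ) (v : ℕ → ℝ) (hv : Summable v)
    (hvar : ∀ (n : ℕ) (x y : ℕ → S), (∀ i, i < n → x i = y i) → |f x - f y| ≤ v n)
    (M : ℝ) (w : ℕ → ℝ) (hw : ∀ n, |w n| ≤ M) (N : ℕ) (x y : ℕ → S)
    (h : ∀ i, i < N → x i = y i) :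
    ∑ k ∈ range N, |w k * f (shift^[k] x) - w k * f (shift^[k] y)| ≤ M * ∑' n, v n := by
  have hM : 0 ≤ M := (abs_nonneg _).trans (hw 0)
  have hv0 : ∀ n, 0 ≤ v n := fun n =>
    (abs_nonneg _).trans (hvar n (fun _ => Classical.arbitrary S) _ fun _ _ => rfl)
  have s1 : ∑ k ∈ range N, |w k * f (shift^[k] x) - w k * f (shift^[k] y)| ≤
      ∑ k ∈ range N, M * v (N - 1 - k + 1) := by
    refine Finset.sum_le_sum fun k hk => ?_
    rw [Finset.mem_range] at hk
    rw [← mul_sub, abs_mul]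
    refine mul_le_mul (hw k) (hvar _ _ _ fun i hi => ?_) (abs_nonneg _) hM
    rw [shift_iter, shift_iter]
    exact h _ (by omega)
  refine s1.trans ?_
  rw [Finset.sum_range_reflect (fun k => M * v (k + 1)), ← Finset.mul_sum]
  gcongr
  have := Summable.sum_le_tsum (range (N + 1)) (fun i _ => hv0 i) hv
  rw [Finset.sum_range_succ'] at this
  linarith [hv0 0]

end bern

theorem log_exp_int_bound {X : Type*} [MeasurableSpace X] (σ : Measure X) [IsProbabilityMeasure σ]
    (u : X → ℝ) (b : ℝ) (hu : ∀ x, |u x| ≤ b) (hi : Integrable (fun x => Real.exp (u x)) σ) :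
    0 < ∫ x, Real.exp (u x) ∂σ ∧ |Real.log (∫ x, Real.exp (u x) ∂σ)| ≤ b := by
  have l1 : Real.exp (-b) ≤ ∫ x, Real.exp (u x) ∂σ := by
    have := integral_mono (μ := σ) (integrable_const (Real.exp (-b))) hi
      fun x => Real.exp_le_exp.2 (abs_le.1 (hu x)).1
    simpa using this
  have l2 : ∫ x, Real.exp (u x) ∂σ ≤ Real.exp b := by
    have := integral_mono (μ := σ) hi (integrable_const (Real.exp b))
      fun x => Real.exp_le_exp.2 (abs_le.1 (hu x)).2
    simpa using this
  have hpos := (Real.exp_pos (-b)).trans_le l1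
  refine ⟨hpos, abs_le.2 ⟨?_, ?_⟩⟩
  · rwa [Real.le_log_iff_exp_le hpos]
  · rwa [Real.log_le_iff_le_exp hpos]

/-- Minimal uniquely ergodic weights: if the orbit closure `Ω_w` of the
weight sequence `w ∈ A^ℕ` under the shift is minimal and uniquely ergodic and `f` is of
bounded variation, then (H1) and (H2) hold for `f_n = w_n · f ∘ T^n`. -/
theorem minimal_uniquely_ergodic_weights {S : Type*} [Fintype S] [TopologicalSpace S]
    [DiscreteTopology S] [MeasurableSpace S] [BorelSpace S] (hq : 2 ≤ Fintype.card S)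
    (σ : Measure (ℕ → S)) [IsProbabilityMeasure σ]
    (hσ : ∀ (m : ℕ) (a : Fin m → S), σ (cyl a) = (Fintype.card S : ℝ≥0∞)⁻¹ ^ m)
    (A : Finset ℝ) (w : ℕ → ℝ) (hw : ∀ n, w n ∈ A)
    (Ωw : Set (ℕ → ℝ)) (hΩw : Ωw = closure {z : ℕ → ℝ | ∃ k : ℕ, z = shift^[k] w})
    (hmin : ∀ y ∈ Ωw, Ωw ⊆ closure {z : ℕ → ℝ | ∃ k : ℕ, z = shift^[k] y})
    (hUE : ∃! m : ProbabilityMeasure (ℕ → ℝ),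
      MeasurePreserving (shift (S := ℝ)) (m : Measure (ℕ → ℝ)) (m : Measure (ℕ → ℝ)) ∧
        (m : Measure (ℕ → ℝ)) Ωw = 1)
    (f : (ℕ → S) → ℝ) (Mf : ℝ) (hfb : ∀ x, |f x| ≤ Mf)
    (v : ℕ → ℝ) (hv : Summable v)
    (hvar : ∀ (n : ℕ) (x y : ℕ → S), (∀ i, i < n → x i = y i) → |f x - f y| ≤ v n) :
    (∀ lam : ℝ, ∃ L : ℝ,
      Tendsto (fun N : ℕ =>
          Real.log (∫ x, Real.exp
            (lam * ∑ n ∈ Finset.range N, w n * f (shift^[n] x)) ∂σ) / N)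
        atTop (𝓝 L)) ∧
    (∃ D : ℝ, ∀ N : ℕ, 1 ≤ N → ∀ x y : ℕ → S, (∀ i, i < N → x i = y i) →
      ∑ k ∈ Finset.range N, |w k * f (shift^[k] x) - w k * f (shift^[k] y)| ≤ D) := by
  have hne : Nonempty S := Fintype.card_pos_iff.1 (by omega)
  obtain ⟨M, hM⟩ : ∃ M : ℝ, ∀ n, |w n| ≤ M := by
    refine ⟨∑ a ∈ A, |a|, fun n => ?_⟩
    exact Finset.single_le_sum (f := fun a : ℝ => |a|) (fun a _ => abs_nonneg a) (hw n)
  have hM0 : 0 ≤ M := (abs_nonneg _).trans (hM 0)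
  have hMf0 : 0 ≤ Mf := (abs_nonneg _).trans (hfb fun _ => Classical.arbitrary S)
  refine ⟨fun lam => ?_, M * ∑' n, v n, fun N _ x y h => distortion f v hv hvar M w hM N x y h⟩
  have hfc : Continuous f := f_cont f v hv.tendsto_atTop_zero hvar
  have hfk : ∀ k, Continuous fun x => f (shift^[k] x) := fun k =>
    hfc.comp (continuous_shift'.iterate k)
  have hSc : ∀ (y : ℕ → ℝ) (m : ℕ), Continuous fun x : ℕ → S =>
      Real.exp (lam * ∑ n ∈ range m, y n * f (shift^[n] x)) := fun y m =>
    Real.continuous_exp.comp (continuous_const.mul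
      (continuous_finsetSum _ fun n _ => continuous_const.mul (hfk n)))
  have hSb : ∀ (y : ℕ → ℝ), (∀ n, |y n| ≤ M) → ∀ (m : ℕ) (x : ℕ → S),
      |lam * ∑ n ∈ range m, y n * f (shift^[n] x)| ≤ m * (|lam| * M * Mf) := by
    intro y hy m x
    rw [abs_mul]
    have : |∑ n ∈ range m, y n * f (shift^[n] x)| ≤ m * (M * Mf) := by
      refine (Finset.abs_sum_le_sum_abs _ _).trans ?_
      refine (Finset.sum_le_card_nsmul _ _ (M * Mf) fun i _ => ?_).trans (by simp)
      rw [abs_mul]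
      exact mul_le_mul (hy i) (hfb _) (abs_nonneg _) hM0
    calc _ ≤ |lam| * (m * (M * Mf)) := by gcongr
      _ = _ := by ring
  set a : (ℕ → ℝ) → ℕ → ℝ := fun y m =>
    Real.log (∫ x, Real.exp (lam * ∑ n ∈ range m, y n * f (shift^[n] x)) ∂σ) with ha
  have hlb : ∀ (y : ℕ → ℝ), (∀ n, |y n| ≤ M) → ∀ m : ℕ,
      0 < ∫ x, Real.exp (lam * ∑ n ∈ range m, y n * f (shift^[n] x)) ∂σ ∧
      |a y m| ≤ m * (|lam| * M * Mf) := fun y hy m =>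
    log_exp_int_bound σ _ _ (hSb y hy m) (cont_int σ (hSc y m))
  have hwi : ∀ i n, |shift^[i] w n| ≤ M := fun i n => by rw [shift_iter]; exact hM _
  have hv0 : 0 ≤ ∑' n, v n := tsum_nonneg fun n =>
    (abs_nonneg _).trans (hvar n (fun _ => Classical.arbitrary S) _ fun _ _ => rfl)
  refine almost_additive_limit (fun i m => a (shift^[i] w) m)
    (2 * (|lam| * (M * ∑' n, v n))) (|lam| * M * Mf) (by positivity) (by positivity) ?_
    (fun i m => (hlb _ (hwi i) m).2) ?_
  · intro i m
    set K : ℝ := |lam| * (M * ∑' n, v n) with hK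
    have q := quasi σ hσ i _ _ (hSc w i) (hSc (shift^[i] w) m) (fun x => Real.exp_pos _)
      (Real.exp K) (Real.exp_pos _).le (by
        intro x y h
        rw [← Real.exp_add, Real.exp_le_exp]
        have d := distortion f v hv hvar M w hM i x y h
        have d1 : |∑ k ∈ range i, w k * f (shift^[k] x) - ∑ k ∈ range i, w k * f (shift^[k] y)|
            ≤ M * ∑' n, v n := by
          rw [← Finset.sum_sub_distrib]
          exact (Finset.abs_sum_le_sum_abs _ _).trans d
        have d2 : |lam * (∑ k ∈ range i, w k * f (shift^[k] x)
            - ∑ k ∈ range i, w k * f (shift^[k] y))| ≤ K := by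
          rw [abs_mul]; exact mul_le_mul_of_nonneg_left d1 (abs_nonneg _)
        have := (abs_le.1 d2).2
        rw [mul_sub] at this
        linarith)
    have e : ∀ x : ℕ → S, Real.exp (lam * ∑ n ∈ range i, w n * f (shift^[n] x)) *
        Real.exp (lam * ∑ n ∈ range m, shift^[i] w n * f (shift^[n] (shift^[i] x)))
        = Real.exp (lam * ∑ n ∈ range (i + m), w n * f (shift^[n] x)) := by
      intro x
      rw [← Real.exp_add, Finset.sum_range_add, mul_add]
      congr 3
      refine Finset.sum_congr rfl fun n _ => ?_
      rw [shift_iter, ← Function.iterate_add_apply, add_comm n i]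
    simp only [e] at q
    have p1 := (hlb w hM i).1
    have p2 := (hlb _ (hwi i) m).1
    have p3 := (hlb w hM (i + m)).1
    have q1 := Real.log_le_log p3 q.1
    have q2 := Real.log_le_log (mul_pos p1 p2) q.2
    rw [Real.log_mul (by positivity) (mul_pos p1 p2).ne', Real.log_mul p1.ne' p2.ne',
      ← Real.exp_add, Real.log_exp] at q1
    rw [Real.log_mul (by positivity) p3.ne', Real.log_mul p1.ne' p2.ne',
      ← Real.exp_add, Real.log_exp] at q2
    change |a w (i + m) - a w i - a (shift^[i] w) m| ≤ 2 * K
    simp only [ha]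
    rw [abs_le]; constructor <;> linarith
  · intro m
    let cl : (ℕ → ℝ) → (ℕ → ℝ) := fun y n => max (-M) (min M (y n))
    have hclc : Continuous cl := continuous_pi fun n =>
      continuous_const.max (continuous_const.min (continuous_apply n))
    have hclb : ∀ y n, |cl y n| ≤ M := fun y n =>
      abs_le.2 ⟨le_max_left _ _, max_le (by linarith) (min_le_left _ _)⟩
    have hcle : ∀ y, (∀ n, |y n| ≤ M) → cl y = y := fun y hy => by
      ext n
      have := abs_le.1 (hy n)
      simp only [cl]
      rw [min_eq_right this.2, max_eq_right this.1]
    have hcont : Continuous fun y => a (cl y) m := by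
      refine Continuous.log ?_ fun y => (hlb _ (hclb y) m).1.ne'
      refine continuous_of_dominated (bound := fun _ => Real.exp (m * (|lam| * M * Mf)))
        (fun y => (hSc (cl y) m).aestronglyMeasurable) (fun y => ?_) (integrable_const _) ?_
      · refine Eventually.of_forall fun x => ?_
        rw [Real.norm_of_nonneg (Real.exp_pos _).le]
        exact Real.exp_le_exp.2 (abs_le.1 (hSb _ (hclb y) m x)).2
      · refine Eventually.of_forall fun x => ?_
        exact Real.continuous_exp.comp (continuous_const.mul
          (continuous_finsetSum _ fun n _ =>
            ((continuous_apply n).comp hclc).mul continuous_const))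
    let g : BoundedContinuousFunction (ℕ → ℝ) ℝ :=
      BoundedContinuousFunction.ofNormedAddCommGroup (fun y => a (cl y) m) hcont
        (m * (|lam| * M * Mf)) fun y => (hlb _ (hclb y) m).2
    obtain ⟨l, hl⟩ := ue_tendsto A w hw Ωw hΩw hUE g
    refine ⟨l, hl.congr fun N => ?_⟩
    congr 1
    refine Finset.sum_congr rfl fun i _ => ?_
    change a (cl (shift^[i] w)) m = _
    rw [hcle _ (hwi i)]
end
end

section
/- (Furman-type theorem without invertibility.) Let Y be a compact metric space and R: Y → Y a continuous map admitting exactly one R-invariant Borel probability measure. Let d ≥ 1 and let A: Y → M_d(ℝ) be a continuous matrix-valued function such that A(y) has nonnegative entries for every y ∈ Y, and suppose there is an integer p ≥ 1 such that for every y ∈ Y the product A(R^{p−1} y)⋯A(Ry)A(y) has all entries strictly positive. Then for every y ∈ Y the limit L(y) := lim_{n→∞} (1/n) log ‖A(R^{n−1} y)⋯A(Ry)A(y)‖ exists, where ‖B‖ denotes the sum of the absolute values of the entries of B; moreover the convergence is uniform in y ∈ Y, and L(y) is the same constant for all y. -/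
open MeasureTheory Filter
open scoped Topology

noncomputable section

/-- The ordered matrix cocycle product `A(R^{n-1}y) ⋯ A(Ry) A(y)`. -/
def prodA {Y : Type*} {d : ℕ} (A : Y → Matrix (Fin d) (Fin d) ℝ) (R : Y → Y) :
    ℕ → Y → Matrix (Fin d) (Fin d) ℝ
  | 0, _ => 1
  | n + 1, y => A (R^[n] y) * prodA A R n y

def empM {Y : Type*} [MeasurableSpace Y] (R : Y → Y) (q : ℕ × Y) : ProbabilityMeasure Y :=
  ⟨((q.1 + 1 : ℕ) : ENNReal)⁻¹ • ∑ j ∈ Finset.range (q.1 + 1), Measure.dirac (R^[j] q.2), ⟨by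
    simp only [Measure.smul_apply, Measure.finsetSum_apply, measure_univ, Finset.sum_const,
      Finset.card_range, smul_eq_mul, nsmul_eq_mul, mul_one]
    exact ENNReal.inv_mul_cancel (by positivity) (by finiteness)⟩⟩

lemma empM_integral {Y : Type*} [TopologicalSpace Y] [MeasurableSpace Y] [BorelSpace Y]
    (R : Y → Y) (q : ℕ × Y) (h : Y → ℝ) (hh : Continuous h) :
    ∫ x, h x ∂(empM R q : Measure Y) =
      (∑ j ∈ Finset.range (q.1 + 1), h (R^[j] q.2)) / ((q.1 : ℝ) + 1) := by
  have : ((empM R q : ProbabilityMeasure Y) : Measure Y) =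
    ((q.1 + 1 : ℕ) : ENNReal)⁻¹ • ∑ j ∈ Finset.range (q.1 + 1), Measure.dirac (R^[j] q.2) := rfl
  rw [this, integral_smul_measure, integral_finsetSum_measure]
  · simp only [integral_dirac' _ _ hh.stronglyMeasurable, ENNReal.toReal_inv,
      ENNReal.toReal_natCast, smul_eq_mul]
    push_cast
    field_simp
  · intro i _
    exact integrable_dirac' hh.stronglyMeasurable (by simp)

lemma empM_tendsto {Y : Type*} [MetricSpace Y] [CompactSpace Y]
    [MeasurableSpace Y] [BorelSpace Y]
    (R : Y → Y) (hRc : Continuous R) (m : ProbabilityMeasure Y)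
    (hm : ∀ μ : ProbabilityMeasure Y, MeasurePreserving R (μ : Measure Y) (μ : Measure Y) → μ = m) :
    Tendsto (empM R) (atTop ×ˢ ⊤) (𝓝 m) := by
  rw [tendsto_iff_ultrafilter]
  intro U hU
  obtain ⟨μ, -, hμ⟩ := isCompact_univ.ultrafilter_le_nhds (U.map (empM R)) (by simp)
  have hμ' : Tendsto (empM R) U (𝓝 μ) := hμ
  rw [← hm μ ?_]
  · exact hμ'
  rw [ProbabilityMeasure.tendsto_iff_forall_integral_tendsto] at hμ'
  refine ⟨hRc.measurable, ?_⟩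
  have : IsProbabilityMeasure (Measure.map R (μ : Measure Y)) :=
    Measure.isProbabilityMeasure_map hRc.aemeasurable
  apply ext_of_forall_integral_eq_of_IsFiniteMeasure
  intro f
  rw [integral_map hRc.aemeasurable f.continuous.aestronglyMeasurable]
  have h1 := hμ' f
  have h2 := hμ' (f.compContinuous ⟨R, hRc⟩)
  have h3 : Tendsto (fun q : ℕ × Y => ∫ x, (f.compContinuous ⟨R, hRc⟩) x ∂(empM R q : Measure Y)
      - ∫ x, f x ∂(empM R q : Measure Y)) (atTop ×ˢ ⊤) (𝓝 0) := by
    have h4 : Tendsto (fun q : ℕ × Y => (2 * ‖f‖) / ((q.1 : ℝ) + 1)) (atTop ×ˢ ⊤) (𝓝 0) := by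
      have : Tendsto (fun n : ℕ => (2 * ‖f‖) / ((n : ℝ) + 1)) atTop (𝓝 0) :=
        Tendsto.div_atTop tendsto_const_nhds
          (tendsto_atTop_add_const_right _ _ tendsto_natCast_atTop_atTop)
      exact this.comp tendsto_fst
    refine squeeze_zero_norm ?_ h4
    intro q
    rw [empM_integral R q _ (by fun_prop), empM_integral R q _ (by fun_prop), ← sub_div,
      ← Finset.sum_sub_distrib, norm_div]
    have : ∀ j, (f.compContinuous ⟨R, hRc⟩) (R^[j] q.2) = f (R^[j+1] q.2) := by
      intro j
      simp [Function.iterate_succ_apply']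
    simp only [this]
    rw [Finset.sum_range_sub (fun j => f (R^[j] q.2))]
    have h5 : ‖(q.1 : ℝ) + 1‖ = q.1 + 1 := by
      rw [Real.norm_of_nonneg]; positivity
    rw [h5]
    gcongr
    calc _ ≤ _ := norm_sub_le _ _
      _ ≤ ‖f‖ + ‖f‖ := add_le_add (f.norm_coe_le_norm _) (f.norm_coe_le_norm _)
      _ = _ := by ring
  have h6 := tendsto_nhds_unique (h2.sub h1) (h3.mono_left hU)
  exact sub_eq_zero.1 h6

/-- Uniform Birkhoff theorem in epsilon form. -/
lemma birkhoff_unif {Y : Type*} [MetricSpace Y] [CompactSpace Y]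
    [MeasurableSpace Y] [BorelSpace Y]
    (R : Y → Y) (hRc : Continuous R) (m : ProbabilityMeasure Y)
    (hm : ∀ μ : ProbabilityMeasure Y, MeasurePreserving R (μ : Measure Y) (μ : Measure Y) → μ = m)
    (h : Y → ℝ) (hh : Continuous h) (ε : ℝ) (hε : 0 < ε) :
    ∃ n0 : ℕ, ∀ n ≥ n0, ∀ y,
      |∑ j ∈ Finset.range n, h (R^[j] y) - n * ∫ x, h x ∂(m : Measure Y)| ≤ n * ε := by
  have h1 := empM_tendsto R hRc m hm
  rw [ProbabilityMeasure.tendsto_iff_forall_integral_tendsto] at h1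
  have h2 := h1 (BoundedContinuousFunction.mkOfCompact ⟨h, hh⟩)
  have h3 := (Metric.tendsto_nhds.1 h2 ε hε)
  rw [eventually_prod_iff] at h3
  obtain ⟨pa, hpa, pb, hpb, H⟩ := h3
  rw [eventually_top] at hpb
  obtain ⟨n0, hn0⟩ := eventually_atTop.1 hpa
  refine ⟨n0 + 1, fun n hn y => ?_⟩
  obtain ⟨k, rfl⟩ : ∃ k, n = k + 1 := ⟨n - 1, by omega⟩
  have h4 := H (hn0 k (by omega)) (hpb y)
  rw [empM_integral R _ _ (by fun_prop), Real.dist_eq] at h4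
  simp only [BoundedContinuousFunction.mkOfCompact_apply, ContinuousMap.coe_mk] at h4
  have hk : (0 : ℝ) < (k : ℝ) + 1 := by positivity
  have h5 : ∑ j ∈ Finset.range (k + 1), h (R^[j] y) - ((k + 1 : ℕ) : ℝ) * ∫ x, h x ∂(m : Measure Y)
      = ((k : ℝ) + 1) * ((∑ j ∈ Finset.range (k + 1), h (R^[j] y)) / ((k : ℝ) + 1)
        - ∫ x, h x ∂(m : Measure Y)) := by
    push_cast
    field_simp
  rw [h5, abs_mul, abs_of_pos hk]
  push_cast
  exact mul_le_mul_of_nonneg_left h4.le hk.le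

lemma sum_shift (u : ℕ → ℝ) (n N : ℕ) :
    ∑ j ∈ Finset.range n, (u (N + j) - u j) = ∑ i ∈ Finset.range N, (u (n + i) - u i) := by
  rw [Finset.sum_sub_distrib, Finset.sum_sub_distrib]
  have h1 := Finset.sum_range_add u N n
  have h2 := Finset.sum_range_add u n N
  rw [add_comm n N] at h2
  linarith

lemma almost_additive {Y : Type*} [MetricSpace Y] [CompactSpace Y] [Nonempty Y]
    [MeasurableSpace Y] [BorelSpace Y]
    (R : Y → Y) (hRc : Continuous R) (m : ProbabilityMeasure Y)
    (hm : ∀ μ : ProbabilityMeasure Y, MeasurePreserving R (μ : Measure Y) (μ : Measure Y) → μ = m)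
    (f : ℕ → Y → ℝ) (hf : ∀ n, Continuous (f n)) (p : ℕ) (K D : ℝ)
    (hK : ∀ N, p ≤ N → ∀ j y, |f (N + j) y - f j y - f N (R^[j] y)| ≤ K)
    (hD : ∀ n y, |f (n + 1) y - f n y| ≤ D) (h0 : ∀ y, |f 0 y| ≤ D) :
    ∃ L : ℝ, TendstoUniformly (fun (n : ℕ) (y : Y) => f n y / n) (fun _ => L) atTop := by
  obtain ⟨y0⟩ := ‹Nonempty Y›
  have hD0 : 0 ≤ D := (abs_nonneg _).trans (h0 y0)
  have hK0 : 0 ≤ K := (abs_nonneg _).trans (hK p le_rfl 0 y0)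
  have hstep : ∀ i n y, |f (n + i) y - f n y| ≤ i * D := by
    intro i n y
    induction i with
    | zero => simp
    | succ i ih =>
      have := hD (n + i) y
      rw [← add_assoc]
      push_cast
      rw [abs_le] at *
      constructor <;> linarith [this.1, this.2, ih.1, ih.2]
  have hi : ∀ i y, |f i y| ≤ i * D + D := by
    intro i y
    have h1 := hstep i 0 y
    have h2 := h0 y
    rw [zero_add] at h1
    rw [abs_le] at *
    constructor <;> linarith [h1.1, h1.2, h2.1, h2.2]
  have key : ∀ δ > 0, ∃ c : ℝ, ∃ n0 : ℕ, ∀ n ≥ n0, ∀ y, |f n y / n - c| ≤ δ := by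
    intro δ hδ
    obtain ⟨N, hN⟩ := exists_nat_gt (max (p : ℝ) ((K + 1) / (δ / 2)))
    have hNp : (p : ℝ) < N := (le_max_left _ _).trans_lt hN
    have hNK : (K + 1) / (δ / 2) < N := (le_max_right _ _).trans_lt hN
    have hpN : p ≤ N := by exact_mod_cast hNp.le
    have hN0 : (0 : ℝ) < N := (Nat.cast_nonneg p).trans_lt hNp
    have hNK' : K + 1 < N * (δ / 2) := by rwa [div_lt_iff₀ (by positivity)] at hNK
    obtain ⟨n0, hn0⟩ := birkhoff_unif R hRc m hm (f N) (hf N) 1 one_pos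
    obtain ⟨n1, hn1⟩ := exists_nat_gt ((2 * N + 1) * D / (δ / 2))
    refine ⟨(∫ x, f N x ∂(m : Measure Y)) / N, max (max n0 n1) 1, fun n hn y => ?_⟩
    have hnn0 : n0 ≤ n := by omega
    have hnn1 : n1 ≤ n := by omega
    have hn_pos : (0 : ℝ) < n := by exact_mod_cast (by omega : 0 < n)
    have hb := hn0 n hnn0 y
    have hnD : (2 * N + 1) * D < n * (δ / 2) := by
      have : (2 * N + 1) * D / (δ / 2) < n := hn1.trans_le (by exact_mod_cast hnn1)
      rwa [div_lt_iff₀ (by positivity)] at this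
    set J := ∫ x, f N x ∂(m : Measure Y) with hJ
    have e1 : |∑ j ∈ Finset.range n, (f (N + j) y - f j y) -
        ∑ j ∈ Finset.range n, f N (R^[j] y)| ≤ n * K := by
      rw [← Finset.sum_sub_distrib]
      refine (Finset.abs_sum_le_sum_abs _ _).trans ?_
      refine (Finset.sum_le_sum fun j _ => hK N hpN j y).trans ?_
      simp
    have e2 : |∑ i ∈ Finset.range N, (f (n + i) y - f i y) - N * f n y| ≤
        N * ((2 * N + 1) * D) := by
      have : (N : ℝ) * f n y = ∑ i ∈ Finset.range N, f n y := by simp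
      rw [this, ← Finset.sum_sub_distrib]
      refine (Finset.abs_sum_le_sum_abs _ _).trans ?_
      refine (Finset.sum_le_sum (g := fun _ => (2 * (N : ℝ) + 1) * D) fun i hiN => ?_).trans ?_
      · have a1 := hstep i n y
        have a2 := hi i y
        have a3 : (i : ℝ) ≤ N := by exact_mod_cast (Finset.mem_range.1 hiN).le
        have a4 : (i : ℝ) * D ≤ N * D := mul_le_mul_of_nonneg_right a3 hD0
        rw [abs_le] at *
        constructor <;> linarith [a1.1, a1.2, a2.1, a2.2]
      · simp
    rw [sum_shift (fun k => f k y) n N] at e1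
    have e3 : |N * f n y - n * J| ≤ N * n * δ := by
      have b1 : (n : ℝ) * (K + 1) ≤ n * (N * (δ / 2)) :=
        mul_le_mul_of_nonneg_left hNK'.le hn_pos.le
      have b2 : (N : ℝ) * ((2 * N + 1) * D) ≤ N * (n * (δ / 2)) :=
        mul_le_mul_of_nonneg_left hnD.le hN0.le
      rw [abs_le] at *
      constructor <;> linarith [e1.1, e1.2, e2.1, e2.2, hb.1, hb.2]
    have e4 : f n y / n - J / N = (N * f n y - n * J) / (N * n) := by
      field_simp
    rw [e4, abs_div, abs_of_pos (mul_pos hN0 hn_pos), div_le_iff₀ (mul_pos hN0 hn_pos)]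
    linarith
  have hcau : CauchySeq (fun n : ℕ => f n y0 / n) := by
    rw [Metric.cauchySeq_iff']
    intro ε hε
    obtain ⟨c, n0, hn0⟩ := key (ε / 3) (by positivity)
    refine ⟨n0, fun n hn => ?_⟩
    have h1 := hn0 n hn y0
    have h2 := hn0 n0 le_rfl y0
    rw [Real.dist_eq]
    rw [abs_le] at h1 h2
    rw [abs_lt]
    constructor <;> linarith [h1.1, h1.2, h2.1, h2.2]
  obtain ⟨L, hL⟩ := cauchySeq_tendsto_of_complete hcau
  refine ⟨L, ?_⟩
  rw [Metric.tendstoUniformly_iff]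
  intro ε hε
  obtain ⟨c, n0, hn0⟩ := key (ε / 3) (by positivity)
  have hLc : |L - c| ≤ ε / 3 := by
    refine le_of_tendsto (hL.sub_const c).abs ?_
    filter_upwards [eventually_ge_atTop n0] with n hn using hn0 n hn y0
  filter_upwards [eventually_ge_atTop n0] with n hn y
  have h1 := hn0 n hn y
  rw [Real.dist_eq]
  rw [abs_le] at h1 hLc
  rw [abs_lt]
  constructor <;> linarith [h1.1, h1.2, hLc.1, hLc.2]

lemma prodA_add {Y : Type*} {d : ℕ} (A : Y → Matrix (Fin d) (Fin d) ℝ) (R : Y → Y)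
    (n m : ℕ) (y : Y) : prodA A R (n + m) y = prodA A R n (R^[m] y) * prodA A R m y := by
  induction n with
  | zero => simp [prodA]
  | succ n ih =>
    rw [show n + 1 + m = (n + m) + 1 by ring, prodA, prodA, ih, Function.iterate_add_apply,
      Matrix.mul_assoc]

lemma prodA_nonneg {Y : Type*} {d : ℕ} (A : Y → Matrix (Fin d) (Fin d) ℝ) (R : Y → Y)
    (hnn : ∀ y i j, 0 ≤ A y i j) (n : ℕ) (y : Y) (i j : Fin d) : 0 ≤ prodA A R n y i j := by
  induction n generalizing i j with
  | zero =>
    rw [prodA, Matrix.one_apply]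
    split_ifs <;> norm_num
  | succ n ih =>
    rw [prodA, Matrix.mul_apply]
    exact Finset.sum_nonneg fun k _ => mul_nonneg (hnn _ _ _) (ih _ _)

lemma prodA_continuous {Y : Type*} [TopologicalSpace Y] {d : ℕ}
    (A : Y → Matrix (Fin d) (Fin d) ℝ) (R : Y → Y)
    (hR : Continuous R) (hA : Continuous A) (n : ℕ) : Continuous (prodA A R n) := by
  induction n with
  | zero => exact continuous_const
  | succ n ih => exact (hA.comp (hR.iterate n)).matrix_mul ih

/-- The entry-sum norm. -/
def entrySum {d : ℕ} (B : Matrix (Fin d) (Fin d) ℝ) : ℝ := ∑ i, ∑ j, |B i j|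

lemma entrySum_mul_le {d : ℕ} (B C : Matrix (Fin d) (Fin d) ℝ) :
    entrySum (B * C) ≤ entrySum B * entrySum C := by
  have hC : ∀ k, ∑ j, |C k j| ≤ entrySum C := fun k =>
    Finset.single_le_sum (f := fun k => ∑ j, |C k j|)
      (fun k _ => Finset.sum_nonneg fun j _ => abs_nonneg _) (Finset.mem_univ k)
  calc entrySum (B * C) ≤ ∑ i, ∑ j, ∑ k, |B i k| * |C k j| := by
        unfold entrySum
        gcongr with i _ j _
        rw [Matrix.mul_apply]
        refine (Finset.abs_sum_le_sum_abs _ _).trans (le_of_eq ?_)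
        simp [abs_mul]
    _ = ∑ i, ∑ k, |B i k| * ∑ j, |C k j| := by
        refine Finset.sum_congr rfl fun i _ => ?_
        rw [Finset.sum_comm]
        simp [Finset.mul_sum]
    _ ≤ ∑ i, ∑ k, |B i k| * entrySum C := by
        gcongr with i _ k _
        exact hC k
    _ = entrySum B * entrySum C := by
        simp [entrySum, Finset.sum_mul]

lemma le_entrySum_mul {d : ℕ} (B P C : Matrix (Fin d) (Fin d) ℝ) (c : ℝ)
    (hB : ∀ i j, 0 ≤ B i j) (hP : ∀ i j, c ≤ P i j) (hC : ∀ i j, 0 ≤ C i j) :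
    c * (entrySum B * entrySum C) ≤ entrySum (B * (P * C)) := by
  calc c * (entrySum B * entrySum C)
      = ∑ i, ∑ j, ∑ k, B i k * ∑ l, c * C l j := by
        have h1 : entrySum B = ∑ i, ∑ k, B i k := by simp [entrySum, abs_of_nonneg (hB _ _)]
        have h2 : entrySum C = ∑ j, ∑ l, C l j := by
          rw [Finset.sum_comm]; simp [entrySum, abs_of_nonneg (hC _ _)]
        rw [h1, h2]
        simp only [← Finset.mul_sum, ← Finset.sum_mul]
        ring
    _ ≤ ∑ i, ∑ j, ∑ k, B i k * ∑ l, P k l * C l j := by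
        gcongr with i _ j _ k _ l _
        · exact hB i k
        · exact hC l j
        · exact hP k l
    _ = ∑ i, ∑ j, (B * (P * C)) i j := by simp [Matrix.mul_apply]
    _ ≤ _ := by
        unfold entrySum
        gcongr
        exact le_abs_self _

/-- Furman-type theorem without invertibility: for a uniquely ergodic
continuous map `R` of a compact metric space and a continuous nonnegative matrix cocycle
whose `p`-step products are strictly positive, the top Lyapunov exponent
`lim (1/n) log ‖A(R^{n-1}y)⋯A(y)‖` exists for every `y`, is a constant, and the
convergence is uniform in `y`. -/
theorem furman_without_invertibility {Y : Type*} [MetricSpace Y] [CompactSpace Y]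
    [MeasurableSpace Y] [BorelSpace Y]
    (R : Y → Y) (hRc : Continuous R)
    (hUE : ∃! m : ProbabilityMeasure Y, MeasurePreserving R (m : Measure Y) (m : Measure Y))
    (d : ℕ) (hd : 1 ≤ d)
    (A : Y → Matrix (Fin d) (Fin d) ℝ) (hA : Continuous A)
    (hnn : ∀ y i j, 0 ≤ A y i j)
    (p : ℕ) (hp : 1 ≤ p)
    (hpos : ∀ y i j, 0 < prodA A R p y i j) :
    ∃ L : ℝ, TendstoUniformly
      (fun (n : ℕ) (y : Y) => Real.log (∑ i, ∑ j, |prodA A R n y i j|) / n)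
      (fun _ => L) atTop := by
  obtain ⟨m, -, hm⟩ := hUE
  have hne : Nonempty Y := nonempty_of_isProbabilityMeasure (m : Measure Y)
  have hcont := prodA_continuous A R hRc hA
  have hnonneg := prodA_nonneg A R hnn
  -- uniform positive lower bound on the entries of the `p`-step product
  obtain ⟨c, hc, hcle⟩ : ∃ c > 0, ∀ y i j, c ≤ prodA A R p y i j := by
    have h1 : ∀ q : Fin d × Fin d, ∃ c > 0, ∀ y, c ≤ prodA A R p y q.1 q.2 := by
      intro q
      have hq : Continuous fun y => prodA A R p y q.1 q.2 := (hcont p).matrix_elem _ _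
      obtain ⟨y0, -, hy0⟩ := isCompact_univ.exists_isMinOn Set.univ_nonempty hq.continuousOn
      exact ⟨_, hpos y0 _ _, fun y => hy0 (Set.mem_univ y)⟩
    choose g hg hg' using h1
    have : Nonempty (Fin d) := ⟨⟨0, hd⟩⟩
    refine ⟨Finset.univ.inf' Finset.univ_nonempty g, ?_, fun y i j => ?_⟩
    · simpa [Finset.lt_inf'_iff] using fun i j => hg (i, j)
    · exact (Finset.inf'_le g (Finset.mem_univ (i, j))).trans (hg' (i, j) y)
  let s : ℕ → Y → ℝ := fun n y => entrySum (prodA A R n y)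
  have hs_nonneg : ∀ n y, 0 ≤ s n y := fun n y =>
    Finset.sum_nonneg fun i _ => Finset.sum_nonneg fun j _ => abs_nonneg _
  have hsa : ∀ n k y, s (n + k) y ≤ s n (R^[k] y) * s k y := by
    intro n k y
    simp only [s]
    rw [prodA_add]
    exact entrySum_mul_le _ _
  have hsb : ∀ n k y, c * (s n (R^[p + k] y) * s k y) ≤ s (n + (p + k)) y := by
    intro n k y
    simp only [s]
    rw [prodA_add, prodA_add]
    exact le_entrySum_mul _ _ _ c (hnonneg _ _) (hcle _) (hnonneg _ _)
  have hs0 : ∀ y, s 0 y = d := by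
    intro y
    simp only [s, entrySum, prodA, Matrix.one_apply]
    simp [apply_ite abs]
  have hd' : (0 : ℝ) < d := by exact_mod_cast hd
  have hspos : ∀ n y, 0 < s n y := by
    have h1 : ∀ k y, 0 < s (p * k) y := by
      intro k y
      induction k with
      | zero => rw [mul_zero, hs0]; exact hd'
      | succ k ih =>
        have := hsb 0 (p * k) y
        rw [hs0, zero_add, show p + p * k = p * (k + 1) by ring] at this
        exact lt_of_lt_of_le (by positivity) this
    intro n y
    have h2 : n ≤ p * n := Nat.le_mul_of_pos_left n hp
    have h3 := hsa (p * n - n) n y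
    rw [Nat.sub_add_cancel h2] at h3
    have h4 := (h1 n y).trans_le h3
    exact pos_of_mul_pos_right h4 (hs_nonneg _ _)
  let f : ℕ → Y → ℝ := fun n y => Real.log (s n y)
  have hfc : ∀ n, Continuous (f n) := by
    intro n
    refine Continuous.log ?_ fun y => (hspos n y).ne'
    refine continuous_finsetSum _ fun i _ => continuous_finsetSum _ fun j _ => ?_
    exact ((hcont n).matrix_elem i j).abs
  have fa : ∀ n k y, f (n + k) y ≤ f n (R^[k] y) + f k y := by
    intro n k y
    simp only [f]
    rw [← Real.log_mul (hspos _ _).ne' (hspos _ _).ne']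
    exact Real.log_le_log (hspos _ _) (hsa n k y)
  have fb : ∀ n k y, Real.log c + (f n (R^[p + k] y) + f k y) ≤ f (n + (p + k)) y := by
    intro n k y
    simp only [f]
    have h1 := hspos n (R^[p + k] y)
    have h2 := hspos k y
    rw [← Real.log_mul h1.ne' h2.ne', ← Real.log_mul hc.ne' (mul_pos h1 h2).ne']
    exact Real.log_le_log (by positivity) (hsb n k y)
  have hbd : ∀ n, ∃ M, ∀ y, |f n y| ≤ M := by
    intro n
    obtain ⟨M, hM⟩ := isCompact_univ.exists_bound_of_continuousOn (hfc n).continuousOn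
    exact ⟨M, fun y => hM y (Set.mem_univ y)⟩
  choose M hM using hbd
  have hc1 := neg_abs_le (Real.log c)
  have hy : Y := Classical.choice hne
  have hM0 : ∀ n, 0 ≤ M n := fun n => (abs_nonneg _).trans (hM n hy)
  have hcc := abs_nonneg (Real.log c)
  refine almost_additive R hRc m hm f hfc p (|Real.log c| + M p)
    (|Real.log c| + M 0 + M 1 + M (p - 1)) ?_ ?_ ?_
  · intro N hN j y
    obtain ⟨n, rfl⟩ : ∃ n, N = n + p := ⟨N - p, by omega⟩
    have h1 := fa (n + p) j y
    have h2 := fb n j y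
    have h3 := fa n p (R^[j] y)
    have h4 := abs_le.1 (hM p (R^[j] y))
    rw [← Function.iterate_add_apply] at h3
    rw [← add_assoc n p j] at h2
    have := hM0 p
    rw [abs_le]
    constructor <;> linarith [h4.1, h4.2]
  · intro n y
    have h1 := fa 1 n y
    have h2 := abs_le.1 (hM 1 (R^[n] y))
    have h3 := fb 0 n y
    have h4 := fa (p - 1) (n + 1) y
    rw [show p - 1 + (n + 1) = 0 + (p + n) by omega] at h4
    have h5 := abs_le.1 (hM (p - 1) (R^[n + 1] y))
    have h6 := abs_le.1 (hM 0 (R^[p + n] y))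
    rw [add_comm 1 n] at h1
    have := hM0 0
    have := hM0 1
    have := hM0 (p - 1)
    rw [abs_le]
    constructor <;> linarith [h2.1, h2.2, h5.1, h5.2, h6.1, h6.2]
  · intro y
    linarith [hM 0 y, hM0 1, hM0 (p - 1)]
end
end
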